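/- arXiv:2205.04252 — 6 statements merged into one kernel-verified Lean document; each statement's English description precedes it below -/
import Mathlib

section
/- Let G be a series-parallel graph with source s and sink t, let k and k' be integers with k ≥ k' ≥ 1, and let O be an allocation of k players and A' an allocation of k' players to s–t paths in G. Then there exists an allocation A of k players to s–t paths in G such that for every edge e of G: (i) ℓ(A_e) ≥ ℓ(A'_e), and (ii) ℓ(A_e) ≤ max{ℓ(A'_e), ℓ(O_e)}, where ℓ(A_e), ℓ(A'_e), ℓ(O_e) denote the number of players whose assigned path uses edge e under A, A', O respectively. -/
/-- Series-parallel graphs, built recursively from a single edge by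
series and parallel composition. -/
inductive SPG : Type
  | edge : SPG
  | series : SPG → SPG → SPG
  | parallel : SPG → SPG → SPG

namespace SPG

/-- Paths from the source to the sink of a series-parallel graph. -/
inductive Path : SPG → Type
  | edge : Path .edge
  | series {C₁ C₂ : SPG} : Path C₁ → Path C₂ → Path (.series C₁ C₂)
  | left {C₁ C₂ : SPG} : Path C₁ → Path (.parallel C₁ C₂)
  | right {C₁ C₂ : SPG} : Path C₂ → Path (.parallel C₁ C₂)

/-- Edges of a series-parallel graph, identified by their position. -/
inductive Edge : SPG → Type
  | here : Edge .edge
  | sl {C₁ C₂ : SPG} : Edge C₁ → Edge (.series C₁ C₂)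
  | sr {C₁ C₂ : SPG} : Edge C₂ → Edge (.series C₁ C₂)
  | pl {C₁ C₂ : SPG} : Edge C₁ → Edge (.parallel C₁ C₂)
  | pr {C₁ C₂ : SPG} : Edge C₂ → Edge (.parallel C₁ C₂)

/-- Whether a source-sink path uses a given edge. -/
def Path.uses : {G : SPG} → Path G → Edge G → Bool
  | .edge, .edge, .here => true
  | .series _ _, .series p₁ _, .sl e => p₁.uses e
  | .series _ _, .series _ p₂, .sr e => p₂.uses e
  | .parallel _ _, .left p, .pl e => p.uses e
  | .parallel _ _, .left _, .pr _ => false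
  | .parallel _ _, .right _, .pl _ => false
  | .parallel _ _, .right p, .pr e => p.uses e

/-- The list of all edges of a series-parallel graph. -/
def edgeList : (G : SPG) → List G.Edge
  | .edge => [.here]
  | .series C₁ C₂ => C₁.edgeList.map .sl ++ C₂.edgeList.map .sr
  | .parallel C₁ C₂ => C₁.edgeList.map .pl ++ C₂.edgeList.map .pr

end SPG

/-- The load of an allocation `A` of `k` players on edge `e`:
the number of players whose assigned path uses `e`. -/
def SPG.load {G : SPG} {k : ℕ} (A : Fin k → G.Path) (e : G.Edge) : ℕ :=
  (Finset.univ.filter fun i => (A i).uses e = true).card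

namespace SPG

theorem Path.exists_lists_of_series {C₁ C₂ : SPG} (L : List (SPG.series C₁ C₂).Path) :
    ∃ (L₁ : List C₁.Path) (L₂ : List C₂.Path), L₁.length = L.length ∧ L₂.length = L.length ∧
      (∀ e, L.countP (·.uses (.sl e)) = L₁.countP (·.uses e)) ∧
      (∀ e, L.countP (·.uses (.sr e)) = L₂.countP (·.uses e)) := by
  induction L with
  | nil => exact ⟨[], [], by simp⟩
  | cons p L ih =>
    obtain ⟨L₁, L₂, h₁, h₂, hl, hr⟩ := ih
    cases p with
    | series p₁ p₂ =>
      exact ⟨p₁ :: L₁, p₂ :: L₂, by simp [h₁, h₂, List.countP_cons, hl, hr, Path.uses]⟩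

theorem Path.exists_lists_of_parallel {C₁ C₂ : SPG} (L : List (parallel C₁ C₂).Path) :
    ∃ (L₁ : List C₁.Path) (L₂ : List C₂.Path), L₁.length + L₂.length = L.length ∧
      (∀ e, L.countP (·.uses (.pl e)) = L₁.countP (·.uses e)) ∧
      (∀ e, L.countP (·.uses (.pr e)) = L₂.countP (·.uses e)) := by
  induction L with
  | nil => exact ⟨[], [], by simp⟩
  | cons p L ih =>
    obtain ⟨L₁, L₂, h, hl, hr⟩ := ih
    cases p with
    | left p =>
      exact ⟨p :: L₁, L₂, by simp; omega, by simp [List.countP_cons, hl, Path.uses],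
        by simp [hr, Path.uses]⟩
    | right p =>
      exact ⟨L₁, p :: L₂, by simp; omega, by simp [hl, Path.uses],
        by simp [List.countP_cons, hr, Path.uses]⟩

theorem Path.exists_series_list {C₁ C₂ : SPG} (L₁ : List C₁.Path) (L₂ : List C₂.Path)
    (h : L₁.length = L₂.length) :
    ∃ L : List (SPG.series C₁ C₂).Path, L.length = L₁.length ∧
      (∀ e, L.countP (·.uses (.sl e)) = L₁.countP (·.uses e)) ∧
      (∀ e, L.countP (·.uses (.sr e)) = L₂.countP (·.uses e)) := by
  induction L₁ generalizing L₂ with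
  | nil =>
    cases L₂ with
    | nil => exact ⟨[], by simp⟩
    | cons p L₂ => simp at h
  | cons p L₁ ih =>
    cases L₂ with
    | nil => simp at h
    | cons q L₂ =>
      obtain ⟨L, hL, hl, hr⟩ := ih L₂ (by simpa using h)
      exact ⟨.series p q :: L, by simp [hL, List.countP_cons, hl, hr, Path.uses]⟩

theorem Path.exists_parallel_list {C₁ C₂ : SPG} (L₁ : List C₁.Path) (L₂ : List C₂.Path) :
    ∃ L : List (parallel C₁ C₂).Path, L.length = L₁.length + L₂.length ∧
      (∀ e, L.countP (·.uses (.pl e)) = L₁.countP (·.uses e)) ∧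
      (∀ e, L.countP (·.uses (.pr e)) = L₂.countP (·.uses e)) :=
  ⟨L₁.map .left ++ L₂.map .right, by
    simp [List.countP_map, Function.comp_def, Path.uses]⟩

theorem Path.countP_uses_here (L : List SPG.edge.Path) :
    L.countP (·.uses .here) = L.length := by
  rw [List.countP_eq_length]
  rintro ⟨⟩ -
  rfl

/-- Any number of players between `|A'|` and `max |A'| |O|` can be routed with loads at least those
of `A'` and at most the pointwise maximum of those of `A'` and `O`. -/
theorem Path.exists_list_between (G : SPG) (O A' : List G.Path) (n : ℕ)
    (hn : A'.length ≤ n) (hn' : n ≤ max A'.length O.length) :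
    ∃ A : List G.Path, A.length = n ∧ ∀ e : G.Edge,
      A'.countP (·.uses e) ≤ A.countP (·.uses e) ∧
      A.countP (·.uses e) ≤ max (A'.countP (·.uses e)) (O.countP (·.uses e)) := by
  induction G generalizing n with
  | edge =>
    refine ⟨List.replicate n .edge, by simp, ?_⟩
    rintro ⟨⟩
    rw [countP_uses_here, countP_uses_here, countP_uses_here, List.length_replicate]
    exact ⟨hn, hn'⟩
  | series C₁ C₂ ih₁ ih₂ =>
    obtain ⟨O₁, O₂, hO₁, hO₂, hOl, hOr⟩ := exists_lists_of_series O
    obtain ⟨B₁, B₂, hB₁, hB₂, hBl, hBr⟩ := exists_lists_of_series A'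
    obtain ⟨A₁, hA₁, h₁⟩ := ih₁ O₁ B₁ n (by omega) (by omega)
    obtain ⟨A₂, hA₂, h₂⟩ := ih₂ O₂ B₂ n (by omega) (by omega)
    obtain ⟨A, hA, hAl, hAr⟩ := exists_series_list A₁ A₂ (by omega)
    refine ⟨A, by omega, ?_⟩
    rintro (_ | e | e | _ | _)
    · rw [hAl, hBl, hOl]
      exact h₁ e
    · rw [hAr, hBr, hOr]
      exact h₂ e
  | parallel C₁ C₂ ih₁ ih₂ =>
    obtain ⟨O₁, O₂, hO, hOl, hOr⟩ := exists_lists_of_parallel O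
    obtain ⟨B₁, B₂, hB, hBl, hBr⟩ := exists_lists_of_parallel A'
    obtain ⟨n₁, n₂, hsum, hn₁, hn₁', hn₂, hn₂'⟩ : ∃ n₁ n₂, n₁ + n₂ = n ∧
        B₁.length ≤ n₁ ∧ n₁ ≤ max B₁.length O₁.length ∧
        B₂.length ≤ n₂ ∧ n₂ ≤ max B₂.length O₂.length := by
      let n₁ := min (max B₁.length O₁.length) (n - B₂.length)
      exact ⟨n₁, n - n₁, by omega, by omega, by omega, by omega, by omega⟩
    obtain ⟨A₁, hA₁, h₁⟩ := ih₁ O₁ B₁ n₁ hn₁ hn₁'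
    obtain ⟨A₂, hA₂, h₂⟩ := ih₂ O₂ B₂ n₂ hn₂ hn₂'
    obtain ⟨A, hA, hAl, hAr⟩ := exists_parallel_list A₁ A₂
    refine ⟨A, by omega, ?_⟩
    rintro (_ | _ | _ | e | e)
    · rw [hAl, hBl, hOl]
      exact h₁ e
    · rw [hAr, hBr, hOr]
      exact h₂ e

theorem load_eq_countP_ofFn {G : SPG} {k : ℕ} (A : Fin k → G.Path) (e : G.Edge) :
    load A e = (List.ofFn A).countP (·.uses e) := by
  rw [load, List.ofFn_eq_map, List.countP_map, ← List.toFinset_finRange,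
    (List.nodup_finRange k).card_eq_countP]
  simp [Function.comp_def]

end SPG

/-- **Feasibility lemma for series-parallel graphs** (Lemma 1).
Given a series-parallel graph and any `k ≥ k' ≥ 1`, let `O` and `A'` be any two
allocations of `k` and `k'` players, respectively, to source-sink paths in the
graph.  Then there always exists an allocation `A` of `k` players such that for
every edge `e`, `ℓ(A'_e) ≤ ℓ(A_e)` and `ℓ(A_e) ≤ max {ℓ(A'_e), ℓ(O_e)}`. -/
theorem feasibility_lemma (G : SPG) (k k' : ℕ) (hk'1 : 1 ≤ k') (hk'k : k' ≤ k)
    (O : Fin k → G.Path) (A' : Fin k' → G.Path) :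
    ∃ A : Fin k → G.Path, ∀ e : G.Edge,
      SPG.load A' e ≤ SPG.load A e ∧
      SPG.load A e ≤ max (SPG.load A' e) (SPG.load O e) := by
  obtain ⟨A, rfl, h⟩ := SPG.Path.exists_list_between G (List.ofFn O) (List.ofFn A') k
    (by simpa using hk'k) (by simp)
  refine ⟨A.get, fun e => ?_⟩
  simpa only [SPG.load_eq_countP_ofFn, List.ofFn_get] using h e
end

section
/- Fix a series-parallel graph with nondecreasing edge cost functions normalized so that c(OPT(1)) = 1, and for each k ∈ ℕ let n_k = max{q ∈ ℕ : c(OPT(q)) < 2^k} and let ℓ*_{ke} be the load on edge e in a fixed optimal allocation of n_k players. Then for any k and any q ≤ n_k, the value k_q computed by the GoWithTheFlow online algorithm when assigning the q-th arriving player satisfies k_q ≤ k. -/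
noncomputable section
open scoped NNReal

/-- The total cost of a load vector `L`: the sum over all edges `e` of `c_e(L e)`. -/
def SPG.cost {G : SPG} (c : G.Edge → ℕ → ℝ≥0) (L : G.Edge → ℕ) : ℝ≥0 :=
  (G.edgeList.map fun e => c e (L e)).sum

/-- The cost of an allocation of `q` players to source-sink paths. -/
def SPG.allocCost {G : SPG} (c : G.Edge → ℕ → ℝ≥0) {q : ℕ} (A : Fin q → G.Path) : ℝ≥0 :=
  SPG.cost c (SPG.load A)

/-- `OPT(q)`: the minimum cost of an allocation of `q` players. -/
def SPG.optCost {G : SPG} (c : G.Edge → ℕ → ℝ≥0) (q : ℕ) : ℝ≥0 :=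
  ⨅ A : Fin q → G.Path, SPG.allocCost c A

/-- The load on edge `e` after the first `q` players of the online stream
`assign` have been assigned. -/
def SPG.loadUpTo {G : SPG} (assign : ℕ → G.Path) (q : ℕ) (e : G.Edge) : ℕ :=
  ((Finset.range q).filter fun j => (assign j).uses e = true).card

/-- Feasibility of level `k` for the current load vector `L`: some source-sink
path has `L e < ℓ*_{k e}` on all of its edges. -/
def SPG.Feasible {G : SPG} (lstar : ℕ → G.Edge → ℕ) (L : G.Edge → ℕ) (k : ℕ) : Prop :=
  ∃ p : G.Path, ∀ e : G.Edge, p.uses e = true → L e < lstar k e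

/-- `k_q`: the minimum feasible level for the current load vector. -/
def SPG.kmin {G : SPG} (lstar : ℕ → G.Edge → ℕ) (L : G.Edge → ℕ) : ℕ :=
  sInf {k | SPG.Feasible lstar L k}

/-- A run of the `GoWithTheFlow` online algorithm: each arriving player `q` is
assigned a source-sink path all of whose edges respect the thresholds
`ℓ*_{k_q e}` for the minimum feasible level `k_q`. -/
def SPG.IsGWTFRun {G : SPG} (lstar : ℕ → G.Edge → ℕ) (assign : ℕ → G.Path) : Prop :=
  ∀ q : ℕ, ∀ e : G.Edge, (assign q).uses e = true →
    SPG.loadUpTo assign q e < lstar (SPG.kmin lstar (SPG.loadUpTo assign q)) e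

/-- `L` is the load vector of an integral flow of value `n` from source to sink. -/
def SPG.IsFlow : (G : SPG) → ℕ → (G.Edge → ℕ) → Prop
  | .edge, n, L => L .here = n
  | .series C₁ C₂, n, L =>
      C₁.IsFlow n (fun e => L (.sl e)) ∧ C₂.IsFlow n (fun e => L (.sr e))
  | .parallel C₁ C₂, n, L =>
      ∃ n₁ n₂, n₁ + n₂ = n ∧ C₁.IsFlow n₁ (fun e => L (.pl e)) ∧
        C₂.IsFlow n₂ (fun e => L (.pr e))

theorem SPG.isFlow_zero (G : SPG) : G.IsFlow 0 (fun _ => 0) := by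
  induction G with
  | edge => rfl
  | series C₁ C₂ ih₁ ih₂ => exact ⟨ih₁, ih₂⟩
  | parallel C₁ C₂ ih₁ ih₂ => exact ⟨0, 0, rfl, ih₁, ih₂⟩

theorem SPG.IsFlow.add_path {G : SPG} (p : G.Path) {n : ℕ} {L : G.Edge → ℕ}
    (h : G.IsFlow n L) :
    G.IsFlow (n + 1) (fun e => L e + if p.uses e = true then 1 else 0) := by
  induction p generalizing n with
  | edge => simpa [SPG.IsFlow, SPG.Path.uses] using h
  | series p₁ p₂ ih₁ ih₂ => exact ⟨ih₁ h.1, ih₂ h.2⟩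
  | left p ih =>
    obtain ⟨n₁, n₂, hn, h₁, h₂⟩ := h
    exact ⟨n₁ + 1, n₂, by omega, ih h₁, by simpa [SPG.Path.uses] using h₂⟩
  | right p ih =>
    obtain ⟨n₁, n₂, hn, h₁, h₂⟩ := h
    exact ⟨n₁, n₂ + 1, by omega, by simpa [SPG.Path.uses] using h₁, ih h₂⟩

theorem SPG.isFlow_card_filter_uses {G : SPG} {ι : Type*} (S : Finset ι) (A : ι → G.Path) :
    G.IsFlow S.card (fun e => (S.filter fun i => (A i).uses e = true).card) := by
  classical
  induction S using Finset.induction_on with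
  | empty => simpa using G.isFlow_zero
  | insert a S ha ih =>
    rw [Finset.card_insert_of_notMem ha]
    convert ih.add_path (A a) using 2 with e
    rw [Finset.filter_insert]
    split_ifs
    · exact Finset.card_insert_of_notMem (by simp [ha])
    · rfl

/-- In a series-parallel graph, a flow of larger value strictly dominates a flow of smaller
value along some source-sink path. -/
theorem SPG.IsFlow.exists_path_lt {G : SPG} {m n : ℕ} {L M : G.Edge → ℕ}
    (hL : G.IsFlow m L) (hM : G.IsFlow n M) (hmn : m < n) :
    ∃ p : G.Path, ∀ e : G.Edge, p.uses e = true → L e < M e := by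
  induction G generalizing m n with
  | edge =>
    refine ⟨.edge, fun e _ => ?_⟩
    cases e
    exact hL.trans_lt (hmn.trans_eq hM.symm)
  | series C₁ C₂ ih₁ ih₂ =>
    obtain ⟨p₁, hp₁⟩ := ih₁ hL.1 hM.1 hmn
    obtain ⟨p₂, hp₂⟩ := ih₂ hL.2 hM.2 hmn
    refine ⟨.series p₁ p₂, fun e he => ?_⟩
    cases e with
    | sl e => exact hp₁ e he
    | sr e => exact hp₂ e he
  | parallel C₁ C₂ ih₁ ih₂ =>
    obtain ⟨m₁, m₂, hm, hL₁, hL₂⟩ := hL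
    obtain ⟨n₁, n₂, hn, hM₁, hM₂⟩ := hM
    rcases lt_or_ge m₁ n₁ with hlt | hge
    · obtain ⟨p, hp⟩ := ih₁ hL₁ hM₁ hlt
      refine ⟨.left p, fun e he => ?_⟩
      cases e with
      | pl e => exact hp e he
      | pr e => simp [SPG.Path.uses] at he
    · obtain ⟨p, hp⟩ := ih₂ hL₂ hM₂ (by omega)
      refine ⟨.right p, fun e he => ?_⟩
      cases e with
      | pl e => simp [SPG.Path.uses] at he
      | pr e => exact hp e he

/-- **Corollary 1.**  Fix a series-parallel graph with nondecreasing edge cost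
functions normalized so that `c(OPT(1)) = 1`; for each `k` let `n_k` be the
largest number of players whose optimal cost is below `2^k`, and let
`ℓ*_{k e}` be the load of edge `e` in a fixed optimal allocation `Ostar k` of
`n_k` players.  Then for any `q ≤ n_k`, the value `k_q` computed by the
`GoWithTheFlow` algorithm when assigning the `q`-th arriving player (i.e. with
the loads of the first `q - 1` players) is well defined and at most `k`. -/
theorem gwtf_level_le (G : SPG) (c : G.Edge → ℕ → ℝ≥0)
    (hmono : ∀ e : G.Edge, Monotone (c e)) (hzero : ∀ e : G.Edge, c e 0 = 0)
    (hnorm : SPG.optCost c 1 = 1)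
    (nk : ℕ → ℕ)
    (hnk : ∀ k : ℕ, SPG.optCost c (nk k) < 2 ^ k ∧
      ∀ q : ℕ, SPG.optCost c q < 2 ^ k → q ≤ nk k)
    (Ostar : (k : ℕ) → Fin (nk k) → G.Path)
    (hOstar : ∀ k : ℕ, ∀ A : Fin (nk k) → G.Path,
      SPG.allocCost c (Ostar k) ≤ SPG.allocCost c A)
    (assign : ℕ → G.Path)
    (hrun : SPG.IsGWTFRun (fun k e => SPG.load (Ostar k) e) assign)
    (k q : ℕ) (hq1 : 1 ≤ q) (hq : q ≤ nk k) :
    {k' | SPG.Feasible (fun k e => SPG.load (Ostar k) e)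
        (SPG.loadUpTo assign (q - 1)) k'}.Nonempty ∧
      SPG.kmin (fun k e => SPG.load (Ostar k) e) (SPG.loadUpTo assign (q - 1)) ≤ k := by
  have hfeas : SPG.Feasible (fun k e => SPG.load (Ostar k) e)
      (SPG.loadUpTo assign (q - 1)) k :=
    (SPG.isFlow_card_filter_uses (Finset.range (q - 1)) assign).exists_path_lt
      (SPG.isFlow_card_filter_uses Finset.univ (Ostar k)) (by simp; omega)
  exact ⟨⟨k, hfeas⟩, Nat.sInf_le hfeas⟩
end
end

section
/- Fix a series-parallel graph with nondecreasing edge cost functions normalized so that c(OPT(1)) = 1, and let A(n) denote the allocation produced by the GoWithTheFlow online algorithm after n players have arrived. Then for every n ≥ 1, c(A(n)) ≤ 4·c(OPT(n)); i.e., GoWithTheFlow is 4-competitive for allocating flows over series-parallel graphs. -/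
noncomputable section
open scoped NNReal

namespace SPG

/-- `L` is the load vector of a source-sink flow of value `q`. -/
def IsFlow_s3 : (G : SPG) → (G.Edge → ℕ) → ℕ → Prop
  | .edge, L, q => L .here = q
  | .series C₁ C₂, L, q => C₁.IsFlow_s3 (fun e => L (.sl e)) q ∧ C₂.IsFlow_s3 (fun e => L (.sr e)) q
  | .parallel C₁ C₂, L, q => ∃ q₁ q₂, q₁ + q₂ = q ∧
      C₁.IsFlow_s3 (fun e => L (.pl e)) q₁ ∧ C₂.IsFlow_s3 (fun e => L (.pr e)) q₂

theorem isFlow_zero_s3 : (G : SPG) → G.IsFlow_s3 (fun _ => 0) 0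
  | .edge => rfl
  | .series C₁ C₂ => ⟨C₁.isFlow_zero_s3, C₂.isFlow_zero_s3⟩
  | .parallel C₁ C₂ => ⟨0, 0, rfl, C₁.isFlow_zero_s3, C₂.isFlow_zero_s3⟩

theorem IsFlow_s3.add_path {G : SPG} (p : G.Path) {L : G.Edge → ℕ} {q : ℕ} (h : G.IsFlow_s3 L q) :
    G.IsFlow_s3 (fun e => (if p.uses e = true then 1 else 0) + L e) (q + 1) := by
  induction p generalizing q with
  | edge =>
    simp only [IsFlow_s3, Path.uses] at h ⊢
    simp [h, add_comm]
  | series p₁ p₂ ih₁ ih₂ => exact ⟨ih₁ h.1, ih₂ h.2⟩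
  | left p ih =>
    obtain ⟨q₁, q₂, rfl, h₁, h₂⟩ := h
    refine ⟨q₁ + 1, q₂, by ring, ih h₁, ?_⟩
    simpa [Path.uses] using h₂
  | right p ih =>
    obtain ⟨q₁, q₂, rfl, h₁, h₂⟩ := h
    refine ⟨q₁, q₂ + 1, by ring, ?_, ih h₂⟩
    simpa [Path.uses] using h₁

theorem isFlow_card_filter_uses_s3 {G : SPG} {ι : Type*} (A : ι → G.Path) (s : Finset ι) :
    G.IsFlow_s3 (fun e => (s.filter fun i => (A i).uses e = true).card) s.card := by
  classical
  simp only [Finset.card_filter]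
  induction s using Finset.induction_on with
  | empty => simpa using G.isFlow_zero_s3
  | insert a s ha ih =>
    simp only [Finset.sum_insert ha, Finset.card_insert_of_notMem ha]
    exact ih.add_path (A a)

/-- In a series-parallel graph, a flow of larger value strictly exceeds one of smaller value
on every edge of some source-sink path. -/
theorem IsFlow_s3.exists_path_lt {G : SPG} {L M : G.Edge → ℕ} {q r : ℕ}
    (hL : G.IsFlow_s3 L q) (hM : G.IsFlow_s3 M r) (hqr : q < r) :
    ∃ p : G.Path, ∀ e, p.uses e = true → L e < M e := by
  induction G generalizing q r with
  | edge =>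
    refine ⟨.edge, ?_⟩
    rintro ⟨⟩ -
    simp only [IsFlow_s3] at hL hM
    omega
  | series C₁ C₂ ih₁ ih₂ =>
    obtain ⟨p₁, h₁⟩ := ih₁ hL.1 hM.1 hqr
    obtain ⟨p₂, h₂⟩ := ih₂ hL.2 hM.2 hqr
    refine ⟨.series p₁ p₂, ?_⟩
    rintro (_ | e | e) h
    exacts [h₁ e h, h₂ e h]
  | parallel C₁ C₂ ih₁ ih₂ =>
    obtain ⟨q₁, q₂, rfl, hL₁, hL₂⟩ := hL
    obtain ⟨r₁, r₂, rfl, hM₁, hM₂⟩ := hM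
    obtain h | h : q₁ < r₁ ∨ q₂ < r₂ := by omega
    · obtain ⟨p, hp⟩ := ih₁ hL₁ hM₁ h
      refine ⟨.left p, ?_⟩
      rintro (_ | _ | _ | e | e) he
      · exact hp e he
      · simp [Path.uses] at he
    · obtain ⟨p, hp⟩ := ih₂ hL₂ hM₂ h
      refine ⟨.right p, ?_⟩
      rintro (_ | _ | _ | e | e) he
      · simp [Path.uses] at he
      · exact hp e he

instance instNonemptyPath : (G : SPG) → Nonempty G.Path
  | .edge => ⟨.edge⟩
  | .series C₁ C₂ =>
    let ⟨p₁⟩ := instNonemptyPath C₁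
    let ⟨p₂⟩ := instNonemptyPath C₂
    ⟨.series p₁ p₂⟩
  | .parallel C₁ _ =>
    let ⟨p⟩ := instNonemptyPath C₁
    ⟨.left p⟩

theorem feasible_load_of_lt {G : SPG} {m : ℕ → ℕ} (O : (k : ℕ) → Fin (m k) → G.Path)
    (assign : ℕ → G.Path) {q k : ℕ} (hq : q < m k) :
    Feasible (fun k e => load (O k) e) (loadUpTo assign q) k :=
  (isFlow_card_filter_uses_s3 assign (Finset.range q)).exists_path_lt
    (isFlow_card_filter_uses_s3 (O k) Finset.univ) (by simpa using hq)

theorem cost_mono {G : SPG} {c : G.Edge → ℕ → ℝ≥0} (hc : ∀ e, Monotone (c e))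
    {L M : G.Edge → ℕ} (h : ∀ e, L e ≤ M e) : cost c L ≤ cost c M :=
  List.sum_le_sum fun e _ => hc e (h e)

theorem cost_le_sum_cost {G : SPG} {c : G.Edge → ℕ → ℝ≥0} (hc : ∀ e, Monotone (c e))
    {ι : Type*} (s : Finset ι) (M : ι → G.Edge → ℕ) {L : G.Edge → ℕ}
    (h : ∀ e, ∃ k ∈ s, L e ≤ M k e) : cost c L ≤ ∑ k ∈ s, cost c (M k) := by
  have hsum : ∑ k ∈ s, cost c (M k) = (G.edgeList.map fun e => ∑ k ∈ s, c e (M k e)).sum := by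
    unfold cost
    induction G.edgeList with
    | nil => simp
    | cons e l ih => simp [Finset.sum_add_distrib, ih]
  rw [hsum]
  refine List.sum_le_sum fun e _ => ?_
  obtain ⟨k, hk, hle⟩ := h e
  exact (hc e hle).trans
    (Finset.single_le_sum (f := fun k => c e (M k e)) (fun _ _ => zero_le) hk)

theorem optCost_one_le {G : SPG} {c : G.Edge → ℕ → ℝ≥0} (hc : ∀ e, Monotone (c e))
    {n : ℕ} (hn : 1 ≤ n) : optCost c 1 ≤ optCost c n := by
  refine le_ciInf fun A => (ciInf_le (OrderBot.bddBelow _) fun _ => A ⟨0, hn⟩).trans ?_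
  refine cost_mono hc fun e => ?_
  refine Finset.card_le_card_of_injOn (fun _ => ⟨0, hn⟩) ?_ fun _ _ _ _ _ => Subsingleton.elim _ _
  intro i hi
  simpa using (Finset.mem_filter.1 hi).2

/-- If every one of the first `n` players is assigned at a level at most `K`, then each edge load
is bounded by a threshold of level at most `K`. -/
theorem IsGWTFRun.exists_loadUpTo_le {G : SPG} {lstar : ℕ → G.Edge → ℕ} {assign : ℕ → G.Path}
    (hrun : IsGWTFRun lstar assign) {n K : ℕ}
    (hK : ∀ q < n, kmin lstar (loadUpTo assign q) ≤ K) (e : G.Edge) :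
    ∃ k ∈ Finset.range (K + 1), loadUpTo assign n e ≤ lstar k e := by
  induction n with
  | zero => exact ⟨0, by simp, by simp [loadUpTo]⟩
  | succ n ih =>
    by_cases he : (assign n).uses e = true
    · refine ⟨_, Finset.mem_range_succ_iff.2 (hK n n.lt_succ_self), ?_⟩
      have h := hrun n e he
      simp only [loadUpTo, Finset.range_add_one, Finset.filter_insert, he, if_true] at h ⊢
      exact (Finset.card_insert_le _ _).trans h
    · have h := ih fun q hq => hK q (by omega)
      simp only [loadUpTo, Finset.range_add_one, Finset.filter_insert, he] at h ⊢
      exact h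

end SPG

/-- **Theorem 2 (competitive ratio of GoWithTheFlow).**  Fix a series-parallel
graph with nondecreasing edge cost functions normalized so that
`c(OPT(1)) = 1`; for each `k` let `n_k` be the largest number of players whose
optimal cost is below `2^k`, and let `ℓ*_{k e}` be the load of edge `e` in a
fixed optimal allocation `Ostar k` of `n_k` players.  Then for every `n ≥ 1`,
the allocation `A(n)` produced by any run of the `GoWithTheFlow` online
algorithm after `n` players have arrived satisfies
`c(A(n)) ≤ 4 · c(OPT(n))`: the algorithm is `4`-competitive. -/
theorem gwtf_four_competitive (G : SPG) (c : G.Edge → ℕ → ℝ≥0)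
    (hmono : ∀ e : G.Edge, Monotone (c e)) (hzero : ∀ e : G.Edge, c e 0 = 0)
    (hnorm : SPG.optCost c 1 = 1)
    (nk : ℕ → ℕ)
    (hnk : ∀ k : ℕ, SPG.optCost c (nk k) < 2 ^ k ∧
      ∀ q : ℕ, SPG.optCost c q < 2 ^ k → q ≤ nk k)
    (Ostar : (k : ℕ) → Fin (nk k) → G.Path)
    (hOstar : ∀ k : ℕ, ∀ A : Fin (nk k) → G.Path,
      SPG.allocCost c (Ostar k) ≤ SPG.allocCost c A)
    (assign : ℕ → G.Path)
    (hrun : SPG.IsGWTFRun (fun k e => SPG.load (Ostar k) e) assign)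
    (n : ℕ) (hn : 1 ≤ n) :
    SPG.cost c (SPG.loadUpTo assign n) ≤ 4 * SPG.optCost c n := by
  have hpow : ∃ k, n ≤ nk k := by
    obtain ⟨k, hk⟩ := pow_unbounded_of_one_lt (SPG.optCost c n) (one_lt_two)
    exact ⟨k, (hnk k).2 n hk⟩
  classical
  obtain ⟨K, hKn, hmin⟩ : ∃ K, n ≤ nk K ∧ ∀ k < K, nk k < n :=
    ⟨Nat.find hpow, Nat.find_spec hpow, fun k hk => not_le.1 (Nat.find_min hpow hk)⟩
  have hlevel : ∀ q < n, SPG.kmin (fun k e => SPG.load (Ostar k) e)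
      (SPG.loadUpTo assign q) ≤ K := fun q hq =>
    Nat.sInf_le (SPG.feasible_load_of_lt Ostar assign (hq.trans_le hKn))
  have hopt : ∀ k, SPG.cost c (SPG.load (Ostar k)) ≤ 2 ^ k := fun k =>
    (le_ciInf (hOstar k)).trans (hnk k).1.le
  have hgeom : ∀ m, ∑ k ∈ Finset.range m, SPG.cost c (SPG.load (Ostar k)) ≤ 2 ^ m := by
    intro m
    induction m with
    | zero => simp
    | succ m ih =>
      rw [Finset.sum_range_succ, pow_succ, mul_two]
      exact add_le_add ih (hopt m)
  have hcost : SPG.cost c (SPG.loadUpTo assign n) ≤ 2 ^ (K + 1) :=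
    (SPG.cost_le_sum_cost hmono _ (fun k => SPG.load (Ostar k))
      (hrun.exists_loadUpTo_le hlevel)).trans (hgeom _)
  have hlower : (1 : ℝ≥0) ≤ SPG.optCost c n := hnorm ▸ SPG.optCost_one_le hmono hn
  obtain _ | K := K
  · calc SPG.cost c (SPG.loadUpTo assign n) ≤ 2 * 1 := by simpa using hcost
      _ ≤ 4 * SPG.optCost c n := by gcongr; norm_num
  · have hK : (2 : ℝ≥0) ^ K ≤ SPG.optCost c n := by
      by_contra! h
      exact absurd ((hnk K).2 n h) (not_le.2 (hmin K K.lt_succ_self))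
    calc SPG.cost c (SPG.loadUpTo assign n) ≤ 4 * 2 ^ K := hcost.trans_eq (by ring)
      _ ≤ 4 * SPG.optCost c n := by gcongr
end
end

section
/- In the parallel-link cost-sharing mechanism with prediction n̂, suppose the prediction overestimates, i.e., n̂ > n where n is the actual number of players. Then in every pure Nash equilibrium p of the induced game, the load ℓ_e of every edge e satisfies ℓ_e ≤ ℓ̂_e, where ℓ̂_e is the load assigned to e by the GoWithTheFlow allocation A(n̂). -/
noncomputable section
open scoped NNReal

namespace ParallelLink

variable {E : Type*} [Fintype E] [DecidableEq E]

/-- The load of an assignment `p` of players to parallel links on edge `e`. -/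
def loadOf {n : ℕ} (p : Fin n → E) (e : E) : ℕ :=
  (Finset.univ.filter fun i => p i = e).card

/-- The total cost of a load vector `L`. -/
def costL (c : E → ℕ → ℝ≥0) (L : E → ℕ) : ℝ≥0 :=
  ∑ e : E, c e (L e)

/-- `c(OPT(q))`: the minimum cost of assigning `q` players to the links. -/
def optCost (c : E → ℕ → ℝ≥0) (q : ℕ) : ℝ≥0 :=
  ⨅ A : Fin q → E, costL c (loadOf A)

/-- The load on edge `e` after the first `q` players of the online stream
`assign` have been assigned (so `loadUpTo assign q` are the loads of the
online allocation `A(q)`). -/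
def loadUpTo (assign : ℕ → E) (q : ℕ) (e : E) : ℕ :=
  ((Finset.range q).filter fun j => assign j = e).card

/-- The modified (penalized) cost function `ĉ_e`:  equal to `c_e` up to the
threshold `ℓ̂_e`, and increasing by at least `W` for each additional user
beyond the threshold. -/
def chat (c : E → ℕ → ℝ≥0) (lhat : E → ℕ) (W : ℝ≥0) (e : E) : ℕ → ℝ≥0
  | 0 => c e 0
  | l + 1 =>
    if l + 1 ≤ lhat e then c e (l + 1)
    else max (chat c lhat W e l + W) (c e (l + 1))

/-- The number of users of edge `e` that precede player `i` in the ordering. -/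
def prevUsers {n : ℕ} (p : Fin n → E) (i : Fin n) (e : E) : ℕ :=
  (Finset.univ.filter fun j => j < i ∧ p j = e).card

/-- The payment of player `i` under the ordered protocol applied to the
modified cost functions: her marginal increase of `ĉ` on the edge she uses. -/
def pay (c : E → ℕ → ℝ≥0) (lhat : E → ℕ) (W : ℝ≥0) {n : ℕ}
    (p : Fin n → E) (i : Fin n) : ℝ≥0 :=
  chat c lhat W (p i) (prevUsers p i (p i) + 1) - chat c lhat W (p i) (prevUsers p i (p i))

/-- Pure Nash equilibrium of the induced parallel-link game: no player can
strictly decrease her payment by unilaterally switching to another link. -/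
def IsPNE (c : E → ℕ → ℝ≥0) (lhat : E → ℕ) (W : ℝ≥0) {n : ℕ} (p : Fin n → E) : Prop :=
  ∀ i : Fin n, ∀ e' : E, pay c lhat W p i ≤ pay c lhat W (Function.update p i e') i

end ParallelLink

open ParallelLink

namespace ParallelLink

section Lemmas

variable {E : Type*}

theorem chat_of_le (c : E → ℕ → ℝ≥0) (lhat : E → ℕ) (W : ℝ≥0) {e : E} {l : ℕ}
    (h : l ≤ lhat e) : chat c lhat W e l = c e l := by
  cases l with
  | zero => rfl
  | succ l => simp [chat, h]

theorem chat_add_le (c : E → ℕ → ℝ≥0) (lhat : E → ℕ) (W : ℝ≥0) {e : E} {l : ℕ}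
    (h : lhat e ≤ l) : chat c lhat W e l + W ≤ chat c lhat W e (l + 1) := by
  simp [chat, Nat.not_le.mpr (Nat.lt_succ_of_le h)]

variable [DecidableEq E]

theorem sum_loadOf [Fintype E] {n : ℕ} (p : Fin n → E) : ∑ e, loadOf p e = n := by
  simpa [loadOf] using
    (Finset.card_eq_sum_card_fiberwise (f := p) (s := Finset.univ) (t := Finset.univ)
      (fun _ _ => Finset.mem_coe.mpr (Finset.mem_univ _))).symm

theorem sum_loadUpTo [Fintype E] (assign : ℕ → E) (q : ℕ) :
    ∑ e, loadUpTo assign q e = q := by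
  simpa [loadUpTo] using
    (Finset.card_eq_sum_card_fiberwise (f := assign) (s := Finset.range q) (t := Finset.univ)
      (fun _ _ => Finset.mem_coe.mpr (Finset.mem_univ _))).symm

theorem prevUsers_update_le_loadOf {n : ℕ} (p : Fin n → E) (i : Fin n) (e e' : E) :
    prevUsers (Function.update p i e') i e ≤ loadOf p e := by
  refine Finset.card_le_card fun j hj => ?_
  obtain ⟨hji, hj⟩ := (Finset.mem_filter.mp hj).2
  rw [Function.update_of_ne hji.ne] at hj
  simp [hj]

/-- The last user of a used edge is preceded by all its other users. -/
theorem exists_prevUsers_add_one_eq_loadOf {n : ℕ} (p : Fin n → E) {e : E}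
    (h : 0 < loadOf p e) : ∃ i, p i = e ∧ prevUsers p i e + 1 = loadOf p e := by
  obtain ⟨i, hi, hmax⟩ := Finset.exists_max_image _ id (Finset.card_pos.mp h)
  refine ⟨i, (Finset.mem_filter.mp hi).2, ?_⟩
  rw [loadOf, ← Finset.card_erase_add_one hi, prevUsers]
  congr 2
  ext j
  simp only [Finset.mem_filter, Finset.mem_univ, true_and, Finset.mem_erase, ne_eq]
  refine ⟨fun hj => ⟨hj.1.ne, hj.2⟩, fun hj => ⟨lt_of_le_of_ne ?_ hj.1, hj.2⟩⟩
  exact hmax j (by simp [hj.2])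

/-- A player joining an edge at or above its threshold pays at least the penalty. -/
theorem le_pay (c : E → ℕ → ℝ≥0) (lhat : E → ℕ) (W : ℝ≥0) {n : ℕ} (p : Fin n → E) (i : Fin n)
    (h : lhat (p i) ≤ prevUsers p i (p i)) : W ≤ pay c lhat W p i :=
  le_tsub_of_add_le_left (chat_add_le c lhat W h)

/-- A player joining an edge below its threshold pays at most the total cost at the thresholds. -/
theorem pay_le_costL [Fintype E] {c : E → ℕ → ℝ≥0} (hmono : ∀ e, Monotone (c e)) (lhat : E → ℕ)
    (W : ℝ≥0) {n : ℕ} (p : Fin n → E) (i : Fin n)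
    (h : prevUsers p i (p i) < lhat (p i)) : pay c lhat W p i ≤ costL c lhat := by
  calc pay c lhat W p i ≤ chat c lhat W (p i) (prevUsers p i (p i) + 1) := tsub_le_self
    _ = c (p i) (prevUsers p i (p i) + 1) := chat_of_le c lhat W h
    _ ≤ c (p i) (lhat (p i)) := hmono _ h
    _ ≤ costL c lhat :=
      Finset.single_le_sum (f := fun e => c e (lhat e)) (fun _ _ => zero_le) (Finset.mem_univ _)

end Lemmas

end ParallelLink

/-- **Overprediction case for parallel links.**  In the parallel-link
cost-sharing mechanism with prediction `n̂` (thresholds `ℓ̂ = loadUpTo assign n̂`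
given by the 4-competitive GoWithTheFlow online allocation `assign`, penalty
`W = c(A(n̂)) + ε` for some `ε > 0`), if `n̂ > n` then in every pure Nash
equilibrium `p` the load of every edge `e` satisfies `ℓ_e ≤ ℓ̂_e`. -/
theorem overprediction_loads_le {E : Type*} [Fintype E] [DecidableEq E] [Nonempty E]
    (c : E → ℕ → ℝ≥0)
    (hmono : ∀ e : E, Monotone (c e)) (hzero : ∀ e : E, c e 0 = 0)
    (assign : ℕ → E)
    (hcomp : ∀ q : ℕ, costL c (loadUpTo assign q) ≤ 4 * optCost c q)
    (n nhat : ℕ) (hover : n < nhat)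
    (ε : ℝ≥0) (hε : 0 < ε)
    (p : Fin n → E)
    (hPNE : IsPNE c (loadUpTo assign nhat) (costL c (loadUpTo assign nhat) + ε) p) :
    ∀ e : E, loadOf p e ≤ loadUpTo assign nhat e := by
  intro e
  by_contra! hlt
  obtain ⟨i, rfl, hi⟩ := exists_prevUsers_add_one_eq_loadOf p (Nat.zero_lt_of_lt hlt)
  obtain ⟨e', -, he'⟩ : ∃ e' ∈ Finset.univ, loadOf p e' < loadUpTo assign nhat e' :=
    Finset.exists_lt_of_sum_lt (by rwa [sum_loadOf, sum_loadUpTo])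
  have hstay := le_pay c (loadUpTo assign nhat) (costL c (loadUpTo assign nhat) + ε) p i (by omega)
  have hmove := pay_le_costL hmono (loadUpTo assign nhat) (costL c (loadUpTo assign nhat) + ε)
    (Function.update p i e') i (by
      rw [Function.update_self]
      exact (prevUsers_update_le_loadOf p i e' e').trans_lt he')
  exact ((hstay.trans (hPNE i e')).trans hmove).not_gt (lt_add_of_pos_right _ hε)
end
end

section
/- Let G be a series-parallel graph and let A and A' be two allocations of the same number k of players to s–t paths in G. If for some component C of the series-parallel decomposition ℓ(A_C) > ℓ(A'_C), then there exists a path p from the source of C to the sink of C such that ℓ(A_e) > ℓ(A'_e) for every edge e ∈ p. -/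
namespace SPG

/-- Positions of components in (a fixed series-parallel decomposition of) a
series-parallel graph: the whole graph is a component, and the two parts of
each series or parallel composition are components. -/
inductive Pos : SPG → Type
  | root (G : SPG) : Pos G
  | sl {C₁ C₂ : SPG} : Pos C₁ → Pos (.series C₁ C₂)
  | sr {C₁ C₂ : SPG} : Pos C₂ → Pos (.series C₁ C₂)
  | pl {C₁ C₂ : SPG} : Pos C₁ → Pos (.parallel C₁ C₂)
  | pr {C₁ C₂ : SPG} : Pos C₂ → Pos (.parallel C₁ C₂)

/-- The series-parallel subgraph (component) sitting at a position. -/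
def Pos.sub : {G : SPG} → Pos G → SPG
  | _, .root G => G
  | _, .sl p => p.sub
  | _, .sr p => p.sub
  | _, .pl p => p.sub
  | _, .pr p => p.sub

/-- Embedding of the edges of the component at position `pos` into the edges
of the ambient graph. -/
def Pos.embedEdge : {G : SPG} → (pos : Pos G) → pos.sub.Edge → G.Edge
  | _, .root _, e => e
  | _, .sl pos, e => .sl (pos.embedEdge e)
  | _, .sr pos, e => .sr (pos.embedEdge e)
  | _, .pl pos, e => .pl (pos.embedEdge e)
  | _, .pr pos, e => .pr (pos.embedEdge e)

/-- Whether a source-sink path of the ambient graph traverses the component at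
position `pos` (i.e. contains a subpath from the component's source to its
sink). -/
def Path.traverses : {G : SPG} → Path G → Pos G → Bool
  | _, _, .root _ => true
  | _, .series p₁ _, .sl pos => p₁.traverses pos
  | _, .series _ p₂, .sr pos => p₂.traverses pos
  | _, .left p, .pl pos => p.traverses pos
  | _, .left _, .pr _ => false
  | _, .right _, .pl _ => false
  | _, .right p, .pr pos => p.traverses pos

end SPG

/-- The component load `ℓ(A_C)`: the number of players whose path traverses the
component at position `pos`. -/
def SPG.loadC {G : SPG} {k : ℕ} (A : Fin k → G.Path) (pos : G.Pos) : ℕ :=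
  (Finset.univ.filter fun i => (A i).traverses pos = true).card

namespace SPG

/-- The part of a path in the first component of a series composition. -/
def Path.fst {C₁ C₂ : SPG} : Path (.series C₁ C₂) → Path C₁
  | .series p₁ _ => p₁

/-- The part of a path in the second component of a series composition. -/
def Path.snd {C₁ C₂ : SPG} : Path (.series C₁ C₂) → Path C₂
  | .series _ p₂ => p₂

/-- The part of a path in the first component of a parallel composition, if any. -/
def Path.left? {C₁ C₂ : SPG} : Path (.parallel C₁ C₂) → Option (Path C₁)
  | .left p => some p
  | .right _ => none

/-- The part of a path in the second component of a parallel composition, if any. -/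
def Path.right? {C₁ C₂ : SPG} : Path (.parallel C₁ C₂) → Option (Path C₂)
  | .left _ => none
  | .right p => some p

/-- The subpath of a path inside the component at a position, if the path traverses it. -/
def Path.restrict : {G : SPG} → Path G → (pos : Pos G) → Option pos.sub.Path
  | _, p, .root _ => some p
  | _, .series p₁ _, .sl pos => p₁.restrict pos
  | _, .series _ p₂, .sr pos => p₂.restrict pos
  | _, .left p, .pl pos => p.restrict pos
  | _, .left _, .pr _ => none
  | _, .right _, .pl _ => none
  | _, .right p, .pr pos => p.restrict pos

theorem Path.isSome_restrict {G : SPG} (p : Path G) (pos : Pos G) :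
    (p.restrict pos).isSome = p.traverses pos := by
  induction pos with
  | root G => cases p <;> rfl
  | sl pos ih => cases p with | series p₁ p₂ => exact ih p₁
  | sr pos ih => cases p with | series p₁ p₂ => exact ih p₂
  | pl pos ih =>
    cases p with
    | left p => exact ih p
    | right p => rfl
  | pr pos ih =>
    cases p with
    | left p => rfl
    | right p => exact ih p

theorem Path.any_uses_restrict {G : SPG} (p : Path G) (pos : Pos G) (e : pos.sub.Edge) :
    (p.restrict pos).any (·.uses e) = p.uses (pos.embedEdge e) := by
  induction pos with
  | root G => cases p <;> rfl
  | sl pos ih => cases p with | series p₁ p₂ => exact ih p₁ e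
  | sr pos ih => cases p with | series p₁ p₂ => exact ih p₂ e
  | pl pos ih =>
    cases p with
    | left p => exact ih p e
    | right p => rfl
  | pr pos ih =>
    cases p with
    | left p => rfl
    | right p => exact ih p e

/-- In an allocation where only some of the players take part, the players taking part are
counted by the two branches of a parallel composition. -/
theorem card_isSome_parallel {ι : Type*} [Fintype ι] {C₁ C₂ : SPG}
    (A : ι → Option (Path (.parallel C₁ C₂))) :
    (Finset.univ.filter fun i => (A i).isSome = true).card =
      (Finset.univ.filter fun i => ((A i).bind Path.left?).isSome = true).card +
      (Finset.univ.filter fun i => ((A i).bind Path.right?).isSome = true).card := by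
  simp only [Finset.card_filter, ← Finset.sum_add_distrib]
  refine Finset.sum_congr rfl fun i _ => ?_
  rcases A i with _ | (p | p) <;> rfl

/-- If more players take part in the allocation `A` than in `A'`, then some path has a greater
load under `A` than under `A'` on each of its edges. -/
theorem exists_overused_path_of_card_isSome_lt {ι : Type*} [Fintype ι] (G : SPG)
    (A A' : ι → Option G.Path)
    (h : (Finset.univ.filter fun i => (A' i).isSome = true).card <
      (Finset.univ.filter fun i => (A i).isSome = true).card) :
    ∃ p : G.Path, ∀ e : G.Edge, p.uses e = true →
      (Finset.univ.filter fun i => (A' i).any (·.uses e) = true).card <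
        (Finset.univ.filter fun i => (A i).any (·.uses e) = true).card := by
  induction G with
  | edge =>
    have any_here (q : Option (Path .edge)) : q.any (·.uses .here) = q.isSome := by
      rcases q with _ | p
      · rfl
      · cases p; rfl
    refine ⟨.edge, fun e _ => ?_⟩
    cases e
    simpa only [any_here] using h
  | series C₁ C₂ ih₁ ih₂ =>
    have any_sl (q : Option (Path (.series C₁ C₂))) (e : C₁.Edge) :
        q.any (·.uses (.sl e)) = (q.map Path.fst).any (·.uses e) := by
      rcases q with _ | ⟨p₁, p₂⟩ <;> rfl
    have any_sr (q : Option (Path (.series C₁ C₂))) (e : C₂.Edge) :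
        q.any (·.uses (.sr e)) = (q.map Path.snd).any (·.uses e) := by
      rcases q with _ | ⟨p₁, p₂⟩ <;> rfl
    obtain ⟨p₁, h₁⟩ := ih₁ (fun i => (A i).map Path.fst) (fun i => (A' i).map Path.fst)
      (by simpa only [Option.isSome_map] using h)
    obtain ⟨p₂, h₂⟩ := ih₂ (fun i => (A i).map Path.snd) (fun i => (A' i).map Path.snd)
      (by simpa only [Option.isSome_map] using h)
    refine ⟨.series p₁ p₂, fun e he => ?_⟩
    cases e with
    | sl e => simpa only [any_sl] using h₁ e he
    | sr e => simpa only [any_sr] using h₂ e he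
  | parallel C₁ C₂ ih₁ ih₂ =>
    have any_pl (q : Option (Path (.parallel C₁ C₂))) (e : C₁.Edge) :
        q.any (·.uses (.pl e)) = (q.bind Path.left?).any (·.uses e) := by
      rcases q with _ | (p | p) <;> rfl
    have any_pr (q : Option (Path (.parallel C₁ C₂))) (e : C₂.Edge) :
        q.any (·.uses (.pr e)) = (q.bind Path.right?).any (·.uses e) := by
      rcases q with _ | (p | p) <;> rfl
    rw [card_isSome_parallel, card_isSome_parallel] at h
    rcases lt_or_lt_of_add_lt_add h with hl | hr
    · obtain ⟨p, hp⟩ := ih₁ _ _ hl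
      refine ⟨.left p, fun e he => ?_⟩
      cases e with
      | pl e => simpa only [any_pl] using hp e he
      | pr e => exact absurd he Bool.false_ne_true
    · obtain ⟨p, hp⟩ := ih₂ _ _ hr
      refine ⟨.right p, fun e he => ?_⟩
      cases e with
      | pl e => exact absurd he Bool.false_ne_true
      | pr e => simpa only [any_pr] using hp e he

end SPG

/-- **Lemma 2 (existence of an over-used path).**  Let `A` and `A'` be two
allocations of the same number `k` of players to source-sink paths of a
series-parallel graph.  If for some component `C` of the series-parallel
decomposition `ℓ(A_C) > ℓ(A'_C)`, then there exists a path `p` from the source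
of `C` to the sink of `C` such that `ℓ(A_e) > ℓ(A'_e)` for every edge
`e ∈ p`. -/
theorem exists_overused_path (G : SPG) (k : ℕ) (A A' : Fin k → G.Path)
    (pos : G.Pos) (h : SPG.loadC A' pos < SPG.loadC A pos) :
    ∃ p : pos.sub.Path, ∀ e : pos.sub.Edge, p.uses e = true →
      SPG.load A' (pos.embedEdge e) < SPG.load A (pos.embedEdge e) := by
  have key := SPG.exists_overused_path_of_card_isSome_lt pos.sub
    (fun i => (A i).restrict pos) (fun i => (A' i).restrict pos)
  simp only [SPG.Path.isSome_restrict, SPG.Path.any_uses_restrict] at key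
  exact key h
end

section
/- In the multicast mechanism for an unknown set of players, let G_{H'} be the graph obtained from MST(H) by removing, for each unmatched predicted vertex v ∈ H∖H', the edge joining v to its parent in MST(H). Then c(G_{H'}) ≤ c(MST(H')), where MST(H') is a minimum spanning tree of the matched predicted vertices H' on the metric closure of the graph. -/
noncomputable section
open scoped NNReal
open Classical

namespace Multicast

variable {V : Type*} [Fintype V] [DecidableEq V]

/-- The weight of a walk: the sum of the weights of its edges. -/
def walkCost (w : Sym2 V → ℝ≥0) {G : SimpleGraph V} {u v : V} (p : G.Walk u v) : ℝ≥0 :=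
  (p.edges.map w).sum

/-- The shortest-path distance `d(u, v)` in the weighted graph `(G, w)`. -/
def gdist (G : SimpleGraph V) (w : Sym2 V → ℝ≥0) (u v : V) : ℝ≥0 :=
  ⨅ p : G.Walk u v, walkCost w p

/-- An edge set `T` connects the vertex set `S` if every two vertices of `S`
are joined by a walk using only edges of `T`. -/
def ConnectsSet (T : Set (Sym2 V)) (S : Set V) : Prop :=
  ∀ u ∈ S, ∀ v ∈ S, (SimpleGraph.fromEdgeSet T).Reachable u v

/-- The minimum Steiner tree cost of the vertex set `S` in the weighted graph
`(G, w)`: the least total weight of a set of edges of `G` connecting `S`. -/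
def steinerCost (G : SimpleGraph V) (w : Sym2 V → ℝ≥0) (S : Set V) : ℝ≥0 :=
  sInf {x | ∃ T : Finset (Sym2 V),
    ↑T ⊆ G.edgeSet ∧ ConnectsSet (↑T) S ∧ x = ∑ e ∈ T, w e}

/-- `par` encodes a spanning tree, rooted at `s`, of the vertex set `S` (in the
metric closure, where any two vertices are adjacent): every vertex of `S` has
its parent in `S` and reaches the root `s` by iterating `par`. -/
def IsSpanningTreeOn (S : Set V) (s : V) (par : V → V) : Prop :=
  par s = s ∧ (∀ v ∈ S, par v ∈ S) ∧ ∀ v ∈ S, ∃ k : ℕ, par^[k] v = s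

/-- The cost of the rooted spanning tree encoded by `par` on the vertex set
`S`: the sum of the distances from each non-root vertex to its parent. -/
def treeCost (d : V → V → ℝ≥0) (S : Finset V) (s : V) (par : V → V) : ℝ≥0 :=
  ∑ v ∈ S.erase s, d v (par v)

/-- The minimum spanning tree cost of `S ∪ {s}` on the metric closure (with
distances `d`). -/
def mstCost (d : V → V → ℝ≥0) (S : Finset V) (s : V) : ℝ≥0 :=
  sInf {x | ∃ par : V → V,
    IsSpanningTreeOn (↑(insert s S)) s par ∧ x = treeCost d (insert s S) s par}

/-- The total length of a list of vertices, viewed as a tour: the sum of the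
distances between consecutive entries. -/
def listCost (d : V → V → ℝ≥0) : List V → ℝ≥0
  | [] => 0
  | [_] => 0
  | a :: b :: rest => d a b + listCost d (b :: rest)

/-- The sum `∑ d(v, p_v)` of the distances from each non-initial entry `v` of
the list to the entry `p_v` immediately preceding it. -/
def listCostRev (d : V → V → ℝ≥0) : List V → ℝ≥0
  | [] => 0
  | [_] => 0
  | a :: b :: rest => d b a + listCostRev d (b :: rest)

/-- `tour` is an Eulerian tour, starting and ending at `s`, of the doubled
rooted spanning tree of `S` encoded by `par`: it visits every vertex of `S`,
moves only along tree edges, and traverses each tree edge exactly twice. -/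
def IsEulerTour (par : V → V) (S : Finset V) (s : V) (tour : List V) : Prop :=
  tour.head? = some s ∧ tour.getLast? = some s ∧ (∀ v ∈ S, v ∈ tour) ∧
  List.Chain' (fun a b => par b = a ∨ par a = b) tour ∧
  ∀ v ∈ S.erase s,
    ((tour.zip tour.tail).count (v, par v) + (tour.zip tour.tail).count (par v, v)) = 2

variable {G : SimpleGraph V}

/-- Player `i` uses edge `e` in the strategy profile `p`. -/
def UsesE {s : V} {n : ℕ} {t : Fin n → V} (p : ∀ i, G.Walk s (t i)) (i : Fin n)
    (e : Sym2 V) : Prop :=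
  e ∈ (p i).edges

/-- Player `i` is charged for edge `e`: she uses it and has the highest
priority (smallest key) among its users. -/
def PaysFor {s : V} {n : ℕ} {t : Fin n → V} (key : Fin n → ℕ)
    (p : ∀ i, G.Walk s (t i)) (i : Fin n) (e : Sym2 V) : Prop :=
  UsesE p i e ∧ ∀ j : Fin n, UsesE p j e → j = i ∨ key i < key j

/-- The cost share `ξ_i(p)` of player `i` under the ordered protocol with
priorities `key`: she pays the full cost of every edge she uses for which she
is the highest-priority user. -/
def share (w : Sym2 V → ℝ≥0) {s : V} {n : ℕ} {t : Fin n → V} (key : Fin n → ℕ)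
    (p : ∀ i, G.Walk s (t i)) (i : Fin n) : ℝ≥0 :=
  ∑ e ∈ (p i).edges.toFinset, if PaysFor key p i e then w e else 0

/-- Pure Nash equilibrium of the multicast game induced by the ordered
protocol: no player can strictly decrease her cost share by unilaterally
switching to another path from `s` to her terminal. -/
def IsPNE (w : Sym2 V → ℝ≥0) {s : V} {n : ℕ} {t : Fin n → V} (key : Fin n → ℕ)
    (p : ∀ i, G.Walk s (t i)) : Prop :=
  ∀ i : Fin n, ∀ q : G.Walk s (t i),
    share w key p i ≤ share w key (Function.update p i q) i

end Multicast

open Multicast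

/-- Replacing the parents of the vertices of `S'` in a rooted spanning tree of a superset `S`
by those of a spanning tree of `S'` with the same root gives a spanning tree of `S`. -/
theorem Multicast.IsSpanningTreeOn.piecewise {V : Type*} {S S' : Set V} {s : V} {par par' : V → V}
    [DecidablePred (· ∈ S')]
    (hs : s ∈ S') (hS : S' ⊆ S) (h : IsSpanningTreeOn S s par)
    (h' : IsSpanningTreeOn S' s par') :
    IsSpanningTreeOn S s (fun v => if v ∈ S' then par' v else par v) := by
  obtain ⟨_, hmem, hreach⟩ := h
  obtain ⟨hroot', hmem', hreach'⟩ := h'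
  have inner : ∀ k : ℕ, ∀ v ∈ S',
      (fun v => if v ∈ S' then par' v else par v)^[k] v = par'^[k] v := by
    intro k
    induction k with
    | zero => intro v _; rfl
    | succ k ih =>
      intro v hv
      simp only [Function.iterate_succ_apply, if_pos hv]
      exact ih _ (hmem' v hv)
  refine ⟨by simp [hs, hroot'], fun v hv => ?_, fun v hv => ?_⟩
  · by_cases hv' : v ∈ S'
    · simpa only [if_pos hv'] using hS (hmem' v hv')
    · simpa only [if_neg hv'] using hmem v hv
  · obtain ⟨k, hk⟩ := hreach v hv
    induction k generalizing v with
    | zero => exact ⟨0, hk⟩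
    | succ k ih =>
      by_cases hv' : v ∈ S'
      · obtain ⟨m, hm⟩ := hreach' v hv'
        exact ⟨m, (inner m v hv').trans hm⟩
      · obtain ⟨m, hm⟩ := ih (par v) (hmem v hv) hk
        exact ⟨m + 1, by simpa only [Function.iterate_succ_apply, if_neg hv'] using hm⟩

/-- **Cost of the pruned forest (within Lemma 5).**  Let `par` encode a minimum
spanning tree `MST(H)` of the predicted vertices `H` (together with the source
`s`) on the metric closure, rooted at `s`, and let `H' ⊆ H` be the matched
predicted vertices.  The forest `G_{H'}` is obtained from `MST(H)` by removing
the edge joining each unmatched vertex `v ∈ H ∖ H'` to its parent; its edges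
are therefore exactly the parent edges of the vertices of `H'`.  Then
`c(G_{H'}) ≤ c(MST(H'))`, where `MST(H')` is a minimum spanning tree of `H'`
(with `s`) on the metric closure. -/
theorem pruned_forest_cost_le_mst {V : Type*} [Fintype V] [DecidableEq V]
    (G : SimpleGraph V) (w : Sym2 V → ℝ≥0) (s : V)
    (H H' : Finset V) (hH' : H' ⊆ H)
    (par : V → V)
    (hpar : IsSpanningTreeOn (↑(insert s H) : Set V) s par)
    (hmst : ∀ par' : V → V, IsSpanningTreeOn (↑(insert s H) : Set V) s par' →
      treeCost (gdist G w) (insert s H) s par ≤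
        treeCost (gdist G w) (insert s H) s par') :
    ∑ v ∈ H'.erase s, gdist G w v (par v) ≤ mstCost (gdist G w) H' s := by
  have split (f : V → ℝ≥0) :
      ∑ v ∈ (insert s H).erase s, f v =
        ∑ v ∈ (H \ H').erase s, f v + ∑ v ∈ H'.erase s, f v := by
    rw [Finset.erase_insert_eq_erase, ← Finset.sum_union]
    · rw [← Finset.erase_union_distrib, Finset.sdiff_union_of_subset hH']
    · exact Finset.sdiff_disjoint.mono (Finset.erase_subset _ _) (Finset.erase_subset _ _)
  refine le_csInf ⟨_, fun _ => s, ⟨rfl, by simp, fun v _ => ⟨1, rfl⟩⟩, rfl⟩ ?_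
  rintro _ ⟨par', hpar', rfl⟩
  have hsub : (↑(insert s H') : Set V) ⊆ ↑(insert s H) := by
    exact_mod_cast Finset.insert_subset_insert s hH'
  have key := hmst _ (hpar.piecewise (by simp) hsub hpar')
  unfold treeCost at key ⊢
  rw [split, split] at key
  have hout : ∑ v ∈ (H \ H').erase s, gdist G w v
      (if v ∈ (↑(insert s H') : Set V) then par' v else par v) =
        ∑ v ∈ (H \ H').erase s, gdist G w v (par v) := by
    refine Finset.sum_congr rfl fun v hv => ?_
    rw [if_neg]
    simp only [Finset.mem_erase, Finset.mem_sdiff] at hv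
    simp [hv.1, hv.2.2]
  have hin : ∑ v ∈ H'.erase s, gdist G w v
      (if v ∈ (↑(insert s H') : Set V) then par' v else par v) =
        ∑ v ∈ H'.erase s, gdist G w v (par' v) := by
    refine Finset.sum_congr rfl fun v hv => ?_
    rw [if_pos]
    simp [Finset.mem_of_mem_erase hv]
  beta_reduce at key
  rw [hout, hin] at key
  rw [Finset.erase_insert_eq_erase]
  exact le_of_add_le_add_left key
end
end
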